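/- Let 𝓓 = (Ω, 𝓑) be a supersimple 2-(n,4,λ) design with n > 12λ + 1, let ∞ ∈ Ω, and suppose G = π_∞(𝓓) is transitive on Ω \ {∞} and preserves a system of imprimitivity with ℓ blocks each of size k. Then 2 ≤ k ≤ λ. -/

import Mathlib

open Equiv

variable {Ω : Type*} [DecidableEq Ω] [Fintype Ω]

/-- Two points of a 4-hypergraph are collinear if they are equal or some line contains both. -/
def HGCollinear (B : Finset (Finset Ω)) (x y : Ω) : Prop :=
  x = y ∨ ∃ b ∈ B, x ∈ b ∧ y ∈ b

/-- A 4-hypergraph is pliable if any two lines sharing three pairwise distinct points are equal. -/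
def HGPliable (B : Finset (Finset Ω)) : Prop :=
  ∀ b₁ ∈ B, ∀ b₂ ∈ B, ∀ p q r : Ω, p ≠ q → p ≠ r → q ≠ r →
    p ∈ b₁ → q ∈ b₁ → r ∈ b₁ → p ∈ b₂ → q ∈ b₂ → r ∈ b₂ → b₁ = b₂

/-- `g` is the elementary move `[x,y]`: it interchanges `x` and `y`, interchanges the
remaining two points of every line through `x` and `y`, and fixes everything else.
For `x = y` it is the identity. -/
def IsElemMove (B : Finset (Finset Ω)) (x y : Ω) (g : Equiv.Perm Ω) : Prop :=
  (x = y ∧ g = 1) ∨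
  (x ≠ y ∧ (∃ b ∈ B, x ∈ b ∧ y ∈ b) ∧ g x = y ∧ g y = x ∧
    ∀ z : Ω, z ≠ x → z ≠ y →
      ((∀ b ∈ B, ¬(x ∈ b ∧ y ∈ b ∧ z ∈ b)) → g z = z) ∧
      (∀ b ∈ B, x ∈ b → y ∈ b → z ∈ b →
        ∀ w ∈ b, w ≠ x → w ≠ y → w ≠ z → g z = w))

/-- `g` is the move sequence `[a₀,…,a_k]` recorded by the list
(elementary moves applied left to right). -/
def IsMoveSeq (B : Finset (Finset Ω)) : List Ω → Equiv.Perm Ω → Prop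
  | [], _ => False
  | [_], g => g = 1
  | a :: b :: l, g => ∃ e h : Equiv.Perm Ω,
      IsElemMove B a b e ∧ IsMoveSeq B (b :: l) h ∧ g = h * e

/-- The puzzle set `𝓛_𝓓` of all move sequences. -/
def puzzleSet (B : Finset (Finset Ω)) : Set (Equiv.Perm Ω) :=
  { g | ∃ l : List Ω, IsMoveSeq B l g }

/-- The hole stabiliser `π_x(𝓓)`: all closed move sequences starting and ending at `x`. -/
def holeStab (B : Finset (Finset Ω)) (x : Ω) : Set (Equiv.Perm Ω) :=
  { g | ∃ l : List Ω, l.head? = some x ∧ l.getLast? = some x ∧ IsMoveSeq B l g }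

/-- `(Ω, B)` is a 2-(n,4,λ) design: lines have four points and every pair of distinct
points lies in exactly `lam` lines. -/
def IsTwoDesign (B : Finset (Finset Ω)) (lam : ℕ) : Prop :=
  (∀ b ∈ B, b.card = 4) ∧
  ∀ p q : Ω, p ≠ q → (B.filter fun b => p ∈ b ∧ q ∈ b).card = lam

/-- Supersimple: any two distinct lines meet in at most two points. -/
def HGSupersimple (B : Finset (Finset Ω)) : Prop :=
  ∀ b₁ ∈ B, ∀ b₂ ∈ B, b₁ ≠ b₂ → (b₁ ∩ b₂).card ≤ 2

/-- `x ∈ overline{a,c}`: `x` is `a`, `c`, or lies on a line containing both `a` and `c`. -/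
def HGLineClosure (B : Finset (Finset Ω)) (a c x : Ω) : Prop :=
  x = a ∨ x = c ∨ ∃ b ∈ B, a ∈ b ∧ c ∈ b ∧ x ∈ b

/-- A system of imprimitivity for the hole stabiliser `π_x` acting on `Ω \ {x}`,
with `ℓ` blocks each of size `k`. -/
def IsHoleBlockSystem (B : Finset (Finset Ω)) (x : Ω) (P : Finset (Finset Ω))
    (k ℓ : ℕ) : Prop :=
  P.card = ℓ ∧ 1 < k ∧ 1 < ℓ ∧ (∀ Δ ∈ P, Δ.card = k) ∧
  (∀ a : Ω, a ≠ x → ∃! Δ : Finset Ω, Δ ∈ P ∧ a ∈ Δ) ∧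
  (∀ Δ ∈ P, x ∉ Δ) ∧
  (∀ g ∈ holeStab B x, ∀ Δ ∈ P, Δ.image (⇑g) ∈ P)

/-- The points other than `p` and `q` lying on a line through `p` and `q`. -/
def thirdPoints (B : Finset (Finset Ω)) (p q : Ω) : Finset Ω :=
  Finset.univ.filter fun r => r ≠ p ∧ r ≠ q ∧ ∃ b ∈ B, p ∈ b ∧ q ∈ b ∧ r ∈ b

theorem mem_thirdPoints {B : Finset (Finset Ω)} {p q r : Ω} :
    r ∈ thirdPoints B p q ↔ r ≠ p ∧ r ≠ q ∧ ∃ b ∈ B, p ∈ b ∧ q ∈ b ∧ r ∈ b := by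
  simp [thirdPoints]

theorem card_thirdPoints_le {B : Finset (Finset Ω)} {lam : ℕ} (hdes : IsTwoDesign B lam)
    {p q : Ω} (hpq : p ≠ q) : (thirdPoints B p q).card ≤ lam * 2 := by
  rw [← hdes.2 p q hpq]
  have hsub : thirdPoints B p q ⊆
      (B.filter fun b => p ∈ b ∧ q ∈ b).biUnion fun b => b \ {p, q} := by
    intro r hr
    obtain ⟨h1, h2, b, hb, hp, hq, hr⟩ := mem_thirdPoints.1 hr
    simp only [Finset.mem_biUnion, Finset.mem_filter, Finset.mem_sdiff, Finset.mem_insert,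
      Finset.mem_singleton]
    exact ⟨b, ⟨hb, hp, hq⟩, hr, by tauto⟩
  refine (Finset.card_le_card hsub).trans (Finset.card_biUnion_le_card_mul _ _ _ ?_)
  intro b hb
  obtain ⟨hb, hp, hq⟩ := Finset.mem_filter.1 hb
  have hs : ({p, q} : Finset Ω) ⊆ b := by
    intro r hr
    simp only [Finset.mem_insert, Finset.mem_singleton] at hr
    rcases hr with rfl | rfl <;> assumption
  rw [Finset.card_sdiff_of_subset hs, hdes.1 b hb, Finset.card_pair hpq]

omit [Fintype Ω] in
theorem HGSupersimple.pliable {B : Finset (Finset Ω)} (hss : HGSupersimple B) :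
    HGPliable B := by
  intro b₁ h₁ b₂ h₂ p q r hpq hpr hqr hp₁ hq₁ hr₁ hp₂ hq₂ hr₂
  by_contra hne
  have hle := hss b₁ h₁ b₂ h₂ hne
  have hs : ({p, q, r} : Finset Ω) ⊆ b₁ ∩ b₂ := by
    intro s hs
    simp only [Finset.mem_insert, Finset.mem_singleton] at hs
    rcases hs with rfl | rfl | rfl <;> simp [*]
  have h3 : ({p, q, r} : Finset Ω).card = 3 := Finset.card_eq_three.2 ⟨p, q, r, hpq, hpr, hqr, rfl⟩
  have := Finset.card_le_card hs
  omega

/-- `z` and `w` are the two points other than `p` and `q` of a line through `p` and `q`. -/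
def CompletesLine (B : Finset (Finset Ω)) (p q z w : Ω) : Prop :=
  z ≠ p ∧ z ≠ q ∧ w ≠ p ∧ w ≠ q ∧ w ≠ z ∧ ∃ b ∈ B, p ∈ b ∧ q ∈ b ∧ z ∈ b ∧ w ∈ b

omit [DecidableEq Ω] [Fintype Ω] in
theorem CompletesLine.symm {B : Finset (Finset Ω)} {p q z w : Ω}
    (h : CompletesLine B p q z w) : CompletesLine B p q w z := by
  obtain ⟨h1, h2, h3, h4, h5, b, hb, hp, hq, hz, hw⟩ := h
  exact ⟨h3, h4, h1, h2, h5.symm, b, hb, hp, hq, hw, hz⟩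

omit [Fintype Ω] in
theorem CompletesLine.unique {B : Finset (Finset Ω)} (hB : ∀ b ∈ B, b.card = 4)
    (hss : HGSupersimple B) {p q z w w' : Ω} (hpq : p ≠ q)
    (h : CompletesLine B p q z w) (h' : CompletesLine B p q z w') : w = w' := by
  obtain ⟨h1, h2, h3, h4, h5, b, hb, hp, hq, hz, hw⟩ := h
  obtain ⟨-, -, h3', h4', h5', b', hb', hp', hq', hz', hw'⟩ := h'
  obtain rfl := hss.pliable b hb b' hb' p q z hpq h1.symm h2.symm hp hq hz hp' hq' hz'
  by_contra hne
  have hs : ({p, q, z, w, w'} : Finset Ω) ⊆ b := by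
    intro s hs
    simp only [Finset.mem_insert, Finset.mem_singleton] at hs
    rcases hs with rfl | rfl | rfl | rfl | rfl <;> assumption
  have h5c : ({p, q, z, w, w'} : Finset Ω).card = 5 := by
    rw [Finset.card_insert_of_notMem, Finset.card_insert_of_notMem,
      Finset.card_insert_of_notMem, Finset.card_pair hne] <;>
      simp only [Finset.mem_insert, Finset.mem_singleton] <;> tauto
  have := Finset.card_le_card hs
  rw [hB b hb] at this
  omega

theorem exists_completesLine {B : Finset (Finset Ω)} (hB : ∀ b ∈ B, b.card = 4) {p q z : Ω}
    (hz : z ∈ thirdPoints B p q) : ∃ w, CompletesLine B p q z w := by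
  obtain ⟨h1, h2, b, hb, hp, hq, hzb⟩ := mem_thirdPoints.1 hz
  have hlt : ({p, q, z} : Finset Ω).card < b.card := by
    rw [hB b hb]
    exact Finset.card_le_three.trans_lt (by norm_num)
  obtain ⟨w, hw, hn⟩ := Finset.exists_mem_notMem_of_card_lt_card hlt
  simp only [Finset.mem_insert, Finset.mem_singleton, not_or] at hn
  exact ⟨w, h1, h2, hn.1, hn.2.1, hn.2.2, b, hb, hp, hq, hzb, hw⟩

open Classical in
theorem exists_isElemMove {B : Finset (Finset Ω)} {lam : ℕ} (hdes : IsTwoDesign B lam)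
    (hlam : 0 < lam) (hss : HGSupersimple B) {p q : Ω} (hpq : p ≠ q) :
    ∃ e, IsElemMove B p q e := by
  have huniq := fun z w w' => CompletesLine.unique (z := z) (w := w) (w' := w') hdes.1 hss hpq
  let f : Ω → Ω := fun z => if z = p then q else if z = q then p else
    if h : ∃ w, CompletesLine B p q z w then h.choose else z
  have hfp : f p = q := by simp [f]
  have hfq : f q = p := by simp [f, hpq.symm]
  have hfc : ∀ z w, CompletesLine B p q z w → f z = w := by
    intro z w h
    have hex : ∃ w, CompletesLine B p q z w := ⟨w, h⟩
    simp only [f, if_neg h.1, if_neg h.2.1, dif_pos hex]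
    exact huniq z _ _ hex.choose_spec h
  have hfn : ∀ z, z ≠ p → z ≠ q → (¬∃ w, CompletesLine B p q z w) → f z = z := by
    intro z h1 h2 h3
    simp only [f, if_neg h1, if_neg h2, dif_neg h3]
  have hinv : Function.Involutive f := by
    intro z
    by_cases h1 : z = p
    · rw [h1, hfp, hfq]
    by_cases h2 : z = q
    · rw [h2, hfq, hfp]
    by_cases h3 : ∃ w, CompletesLine B p q z w
    · obtain ⟨w, hw⟩ := h3
      rw [hfc z w hw, hfc w z hw.symm]
    · rw [hfn z h1 h2 h3, hfn z h1 h2 h3]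
  refine ⟨hinv.toPerm, Or.inr ⟨hpq, ?_, hfp, hfq, ?_⟩⟩
  · have hpos : 0 < (B.filter fun b => p ∈ b ∧ q ∈ b).card := by rwa [hdes.2 p q hpq]
    obtain ⟨b, hb⟩ := Finset.card_pos.1 hpos
    exact ⟨b, (Finset.mem_filter.1 hb).1, (Finset.mem_filter.1 hb).2⟩
  · intro z h1 h2
    refine ⟨fun h => hfn z h1 h2 ?_, fun b hb hp hq hz w hw h3 h4 h5 =>
      hfc z w ⟨h1, h2, h3, h4, h5, b, hb, hp, hq, hz, hw⟩⟩
    rintro ⟨w, -, -, -, -, -, b, hb, hp, hq, hz, -⟩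
    exact h b hb ⟨hp, hq, hz⟩

section

variable {B : Finset (Finset Ω)} {p q z w : Ω} {e : Perm Ω}

omit [DecidableEq Ω] [Fintype Ω] in
theorem IsElemMove.apply_left (h : IsElemMove B p q e) : e p = q := by
  obtain ⟨rfl, rfl⟩ | ⟨-, -, h, -⟩ := h
  · rfl
  · exact h

omit [DecidableEq Ω] [Fintype Ω] in
theorem IsElemMove.apply_right (h : IsElemMove B p q e) : e q = p := by
  obtain ⟨rfl, rfl⟩ | ⟨-, -, -, h, -⟩ := h
  · rfl
  · exact h

theorem IsElemMove.apply_of_notMem (h : IsElemMove B p q e) (hp : z ≠ p) (hq : z ≠ q)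
    (hz : z ∉ thirdPoints B p q) : e z = z := by
  obtain ⟨rfl, rfl⟩ | ⟨-, -, -, -, h⟩ := h
  · rfl
  · refine (h z hp hq).1 fun b hb hm => hz (mem_thirdPoints.2 ⟨hp, hq, b, hb, hm⟩)

omit [DecidableEq Ω] [Fintype Ω] in
theorem IsElemMove.apply_of_completesLine (h : IsElemMove B p q e) (hpq : p ≠ q)
    (hc : CompletesLine B p q z w) : e z = w := by
  obtain ⟨h1, h2, h3, h4, h5, b, hb, hp, hq, hz, hw⟩ := hc
  obtain ⟨h, -⟩ | ⟨-, -, -, -, h⟩ := h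
  · exact absurd h hpq
  · exact (h z h1 h2).2 b hb hp hq hz w hw h3 h4 h5

end

/-- If `[x,a]` sends `z` to `w`, the closed move sequence `[x,a,b,x]` sends `a` to `b` and
`z` to `w`, unless `b` is collinear with two of `x`, `a`, `w`. -/
theorem exists_mem_holeStab {B : Finset (Finset Ω)} {lam : ℕ} (hdes : IsTwoDesign B lam)
    (hlam : 0 < lam) (hss : HGSupersimple B) {x a b z w : Ω} (hxa : x ≠ a) (hxb : x ≠ b)
    (hab : a ≠ b) (hwx : w ≠ x) (hwa : w ≠ a) (hwb : w ≠ b)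
    (hzw : ∀ e, IsElemMove B x a e → e z = w)
    (h₁ : b ∉ thirdPoints B x a) (h₂ : b ∉ thirdPoints B a w) (h₃ : b ∉ thirdPoints B w x) :
    ∃ g ∈ holeStab B x, g a = b ∧ g z = w := by
  obtain ⟨e₁, he₁⟩ := exists_isElemMove hdes hlam hss hxa
  obtain ⟨e₂, he₂⟩ := exists_isElemMove hdes hlam hss hab
  obtain ⟨e₃, he₃⟩ := exists_isElemMove hdes hlam hss hxb.symm
  have hx : x ∉ thirdPoints B a b := by
    intro h
    obtain ⟨-, -, l, hl, ha, hb, hx⟩ := mem_thirdPoints.1 h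
    exact h₁ (mem_thirdPoints.2 ⟨hxb.symm, hab.symm, l, hl, hx, ha, hb⟩)
  have hw₂ : w ∉ thirdPoints B a b := by
    intro h
    obtain ⟨-, -, l, hl, ha, hb, hw⟩ := mem_thirdPoints.1 h
    exact h₂ (mem_thirdPoints.2 ⟨hab.symm, hwb.symm, l, hl, ha, hw, hb⟩)
  have hw₃ : w ∉ thirdPoints B b x := by
    intro h
    obtain ⟨-, -, l, hl, hb, hx, hw⟩ := mem_thirdPoints.1 h
    exact h₃ (mem_thirdPoints.2 ⟨hwb.symm, hxb.symm, l, hl, hw, hx, hb⟩)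
  refine ⟨e₃ * e₂ * e₁, ⟨[x, a, b, x], rfl, rfl, e₁, e₃ * e₂, he₁, ⟨e₂, e₃, he₂,
    ⟨e₃, 1, he₃, rfl, (one_mul _).symm⟩, rfl⟩, rfl⟩, ?_, ?_⟩
  · simp only [Perm.mul_apply]
    rw [he₁.apply_right, he₂.apply_of_notMem hxa hxb hx, he₃.apply_right]
  · simp only [Perm.mul_apply]
    rw [hzw e₁ he₁, he₂.apply_of_notMem hwa hwb hw₂, he₃.apply_of_notMem hwb hwx hw₃]

/-- If `[x,a]` sends a second point `z` of the block `Δ` of `a` to `w`, then every point lies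
in `Δ`, in the block of `w`, or on a line through two of `x`, `a`, `w`. -/
theorem IsHoleBlockSystem.card_le {B : Finset (Finset Ω)} {lam : ℕ}
    (hdes : IsTwoDesign B lam) (hlam : 0 < lam) (hss : HGSupersimple B) {x : Ω}
    {P : Finset (Finset Ω)} {k ℓ : ℕ} (hP : IsHoleBlockSystem B x P k ℓ)
    {Δ Δ' : Finset Ω} (hΔ : Δ ∈ P) (hΔ' : Δ' ∈ P) {a z w : Ω} (ha : a ∈ Δ) (hz : z ∈ Δ)
    (hw : w ∈ Δ') (hwa : w ≠ a) (hzw : ∀ e, IsElemMove B x a e → e z = w) :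
    Fintype.card Ω ≤ 1 + (Δ ∪ Δ').card + 3 * (lam * 2) := by
  obtain ⟨-, -, -, -, huniq, hx, hinv⟩ := hP
  have hax : a ≠ x := fun h => hx Δ hΔ (h ▸ ha)
  have hwx : w ≠ x := fun h => hx Δ' hΔ' (h ▸ hw)
  have hcover : (Finset.univ : Finset Ω) ⊆ {x} ∪ (Δ ∪ Δ') ∪
      (thirdPoints B x a ∪ (thirdPoints B a w ∪ thirdPoints B w x)) := by
    intro b _
    by_contra hb
    simp only [Finset.mem_union, Finset.mem_singleton, not_or] at hb
    obtain ⟨⟨hbx, hbΔ, hbΔ'⟩, h₁, h₂, h₃⟩ := hb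
    have hab : a ≠ b := fun h => hbΔ (h ▸ ha)
    have hwb : w ≠ b := fun h => hbΔ' (h ▸ hw)
    obtain ⟨g, hg, hga, hgz⟩ := exists_mem_holeStab hdes hlam hss hax.symm (Ne.symm hbx) hab
      hwx hwa hwb hzw h₁ h₂ h₃
    have hbg : b ∈ Δ.image g := hga ▸ Finset.mem_image_of_mem g ha
    have hwg : w ∈ Δ.image g := hgz ▸ Finset.mem_image_of_mem g hz
    rw [(huniq w hwx).unique ⟨hinv g hg Δ hΔ, hwg⟩ ⟨hΔ', hw⟩] at hbg
    exact hbΔ' hbg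
  have hcard := Finset.card_le_card hcover
  rw [Finset.card_univ] at hcard
  have c₁ := card_thirdPoints_le hdes hax.symm
  have c₂ := card_thirdPoints_le hdes hwa.symm
  have c₃ := card_thirdPoints_le hdes hwx
  have u₁ := Finset.card_union_le ({x} ∪ (Δ ∪ Δ'))
    (thirdPoints B x a ∪ (thirdPoints B a w ∪ thirdPoints B w x))
  have u₂ := Finset.card_union_le {x} (Δ ∪ Δ')
  have u₃ := Finset.card_union_le (thirdPoints B x a) (thirdPoints B a w ∪ thirdPoints B w x)
  have u₄ := Finset.card_union_le (thirdPoints B a w) (thirdPoints B w x)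
  rw [Finset.card_singleton] at u₂
  omega

/-- (Lemma 5.6) If `n > 12λ + 1` and the hole stabilizer is transitive
and preserves a system of imprimitivity with `ℓ` blocks of size `k`, then `2 ≤ k ≤ λ`. -/
theorem stmt12 (B : Finset (Finset Ω)) (n lam : ℕ) (hn : Fintype.card Ω = n)
    (hlam : 0 < lam) (hdes : IsTwoDesign B lam) (hss : HGSupersimple B)
    (hbig : 12 * lam + 1 < n) (x : Ω)
    (htrans : ∀ a b : Ω, a ≠ x → b ≠ x → ∃ g ∈ holeStab B x, g a = b)
    (P : Finset (Finset Ω)) (k ℓ : ℕ) (hP : IsHoleBlockSystem B x P k ℓ) :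
    2 ≤ k ∧ k ≤ lam := by
  exfalso
  obtain ⟨hPl, hk, hl, hPk, huniq, hx, -⟩ := id hP
  obtain ⟨Δ, hΔ, Δ₂, hΔ₂, hne⟩ := Finset.one_lt_card.1 (hPl ▸ hl)
  have hmem : ∀ Δ ∈ P, ∀ a ∈ Δ, a ≠ x := fun Δ hΔ a ha h => hx Δ hΔ (h ▸ ha)
  have htwo : 2 * k + 1 ≤ n := by
    have hdisj : Disjoint Δ Δ₂ := by
      rw [Finset.disjoint_left]
      exact fun a ha ha₂ => hne ((huniq a (hmem Δ hΔ a ha)).unique ⟨hΔ, ha⟩ ⟨hΔ₂, ha₂⟩)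
    have hxn : x ∉ Δ ∪ Δ₂ := by simp [hx Δ hΔ, hx Δ₂ hΔ₂]
    have := Finset.card_le_univ (insert x (Δ ∪ Δ₂))
    rw [Finset.card_insert_of_notMem hxn, Finset.card_union_of_disjoint hdisj, hPk Δ hΔ,
      hPk Δ₂ hΔ₂] at this
    omega
  obtain ⟨a, ha, z, hz, haz⟩ := Finset.one_lt_card.1 (hPk Δ hΔ ▸ hk)
  have hax := hmem Δ hΔ a ha
  have hthird : ∀ y ∈ Δ, y ≠ a → y ∈ thirdPoints B x a := by
    intro y hy hya
    by_contra hn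
    have := hP.card_le hdes hlam hss hΔ hΔ ha hy hy hya
      fun e he => he.apply_of_notMem (hmem Δ hΔ y hy) hya hn
    rw [Finset.union_self, hPk Δ hΔ] at this
    omega
  have hkle : k ≤ lam * 2 + 1 := by
    have hs : Δ.erase a ⊆ thirdPoints B x a := fun y hy =>
      hthird y (Finset.mem_of_mem_erase hy) (Finset.ne_of_mem_erase hy)
    have h := (Finset.card_le_card hs).trans (card_thirdPoints_le hdes hax.symm)
    rw [Finset.card_erase_of_mem ha, hPk Δ hΔ] at h
    omega
  obtain ⟨w, hw⟩ := exists_completesLine hdes.1 (hthird z hz haz.symm)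
  obtain ⟨Δ', ⟨hΔ', hwΔ'⟩, -⟩ := huniq w hw.2.2.1
  have := hP.card_le hdes hlam hss hΔ hΔ' ha hz hwΔ' hw.2.2.2.1
    fun e he => he.apply_of_completesLine hax.symm hw
  have hu := Finset.card_union_le Δ Δ'
  rw [hPk Δ hΔ, hPk Δ' hΔ'] at hu
  omega
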